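/- Let A = {1,…,k} with k ≥ 3. For any two reversible gates F and G over A, m(F ⊗ G) = gcd(m(F), m(G)), where m(H) denotes the largest m such that H is mod-m-preserving (with m(H) = 0 if no largest such m exists), and F ⊗ G is the tensor product gate. -/

import Mathlib

/-- A reversible gate function of arity `n` over alphabet `A`: a bijection `A^n → A^n`. -/
abbrev GateFun (A : Type*) (n : ℕ) := (Fin n → A) ≃ (Fin n → A)

/-- A reversible gate over alphabet `A`: an arity together with a bijection of that arity. -/
abbrev Gate (A : Type*) := Σ n : ℕ, GateFun A n

/-- The canonical identification `A^{n+m} ≃ A^n × A^m`. -/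
def splitEquiv (A : Type*) (n m : ℕ) :
    (Fin (n + m) → A) ≃ ((Fin n → A) × (Fin m → A)) :=
  (Equiv.arrowCongr finSumFinEquiv.symm (Equiv.refl A)).trans
    (Equiv.sumArrowEquivProdArrow _ _ A)

/-- The permutation gate `P_σ`, mapping `(a_1,…,a_n)` to `(a_{σ(1)},…,a_{σ(n)})`. -/
def permGate (A : Type*) {n : ℕ} (σ : Equiv.Perm (Fin n)) : GateFun A n :=
  Equiv.arrowCongr σ.symm (Equiv.refl A)

/-- Tensor product of gates. -/
def tensorGate {A : Type*} {n m : ℕ} (F : GateFun A n) (G : GateFun A m) :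
    GateFun A (n + m) :=
  ((splitEquiv A n m).trans (F.prodCongr G)).trans (splitEquiv A n m).symm

/-- The generation relation: `Generates S g` means `g` can be generated from the set `S`
of reversible gates using the permutation, tensor product, composition and ancilla rules. -/
inductive Generates {A : Type*} (S : Set (Gate A)) : Gate A → Prop
  | mem {g : Gate A} : g ∈ S → Generates S g
  | perm (n : ℕ) (σ : Equiv.Perm (Fin n)) : Generates S ⟨n, permGate A σ⟩
  | tensor {n m : ℕ} {F : GateFun A n} {G : GateFun A m} :
      Generates S ⟨n, F⟩ → Generates S ⟨m, G⟩ → Generates S ⟨n + m, tensorGate F G⟩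
  | comp {n : ℕ} {F G : GateFun A n} :
      Generates S ⟨n, F⟩ → Generates S ⟨n, G⟩ → Generates S ⟨n, G.trans F⟩
  | ancilla {l m : ℕ} {F : GateFun A (l + m)} (a : Fin l → A) {F' : GateFun A m} :
      Generates S ⟨l + m, F⟩ →
      (∀ b : Fin m → A,
        F ((splitEquiv A l m).symm (a, b)) = (splitEquiv A l m).symm (a, F' b)) →
      Generates S ⟨m, F'⟩

/-- The gate class `⟨S⟩` generated by a set `S` of reversible gates. -/
def genClosure {A : Type*} (S : Set (Gate A)) : Set (Gate A) := {g | Generates S g}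

/-- A reversible gate class: a set of gates closed under the generation rules. -/
def IsGateClass {A : Type*} (S : Set (Gate A)) : Prop := ∀ g, Generates S g → g ∈ S

/-- The transposition gate `τ_{u,v}` exchanging the inputs `u` and `v`. -/
def tau {A : Type*} [DecidableEq A] {n : ℕ} (u v : Fin n → A) : GateFun A n :=
  Equiv.swap u v

/-- The controlled gate `w-F`, mapping `w u` to `w F(u)` and fixing all other inputs. -/
def controlled {A : Type*} [DecidableEq A] {l n : ℕ} (w : Fin l → A) (F : GateFun A n) :
    GateFun A (l + n) :=
  ((splitEquiv A l n).trans
    (Equiv.prodCongrRight fun p => if p = w then F else Equiv.refl _)).trans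
    (splitEquiv A l n).symm

/-- `SWAP_{a,b}` for single symbols `a`, `b`: exchanges `ab` and `ba`. -/
def swapGate {A : Type*} [DecidableEq A] (a b : A) : GateFun A 2 :=
  tau ![a, b] ![b, a]

/-- Number of occurrences of the symbol `a` in the string `x`. -/
def countOf {A : Type*} [DecidableEq A] {n : ℕ} (a : A) (x : Fin n → A) : ℕ :=
  (Finset.univ.filter fun i => x i = a).card

/-- `c_k(x)`: the number of occurrences of the symbol `k` (the top element `⟨k-1,_⟩`
of `Fin k`) in the string `x`. -/
def countLast {k n : ℕ} (x : Fin n → Fin k) : ℕ :=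
  (Finset.univ.filter fun i => (x i : ℕ) = k - 1).card

/-- A gate is mod-`m`-preserving if it preserves the number of `k` symbols mod `m`
(for `m = 0` this means preserving it exactly). -/
def ModPreserving {k : ℕ} (m : ℕ) (g : Gate (Fin k)) : Prop :=
  ∀ w, countLast (g.2 w) ≡ countLast w [MOD m]

/-- `IsModIndex g M` states that `M = m(g)`: the gate `g` is mod-`M`-preserving and
every `m` for which `g` is mod-`m`-preserving divides `M`. (Equivalently, `M` is the
largest modulus preserved by `g`, with `M = 0` when no largest one exists.) -/
def IsModIndex {k : ℕ} (g : Gate (Fin k)) (M : ℕ) : Prop :=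
  ModPreserving M g ∧ ∀ m, ModPreserving m g → m ∣ M

theorem splitEquiv_symm_apply {A : Type*} {n m : ℕ} (u : Fin n → A) (v : Fin m → A) :
    (splitEquiv A n m).symm (u, v) = Fin.append u v := by
  rw [Equiv.symm_apply_eq]
  ext i <;> simp [splitEquiv]

theorem tensorGate_append {A : Type*} {n m : ℕ} (F : GateFun A n) (G : GateFun A m)
    (u : Fin n → A) (v : Fin m → A) :
    tensorGate F G (Fin.append u v) = Fin.append (F u) (G v) := by
  simp [tensorGate, ← splitEquiv_symm_apply]

theorem countLast_append {k n m : ℕ} (u : Fin n → Fin k) (v : Fin m → Fin k) :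
    countLast (Fin.append u v) = countLast u + countLast v := by
  simp only [countLast, Finset.card_filter, Fin.sum_univ_add, Fin.append_left, Fin.append_right]

theorem modPreserving_tensorGate_iff {k n m d : ℕ} (F : GateFun (Fin k) n)
    (G : GateFun (Fin k) m) :
    ModPreserving d (⟨n + m, tensorGate F G⟩ : Gate (Fin k)) ↔
      ∀ u v, countLast (F u) + countLast (G v) ≡ countLast u + countLast v [MOD d] := by
  refine ⟨fun h u v => ?_, fun h w => ?_⟩
  · simpa only [tensorGate_append, countLast_append] using h (Fin.append u v)
  · obtain ⟨⟨u, v⟩, rfl⟩ := (splitEquiv (Fin k) n m).symm.surjective w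
    simpa only [splitEquiv_symm_apply, tensorGate_append, countLast_append] using h u v

/-- The generating function of `countLast` over all strings of length `n`. -/
theorem sum_pow_countLast {R : Type*} [CommRing R] {k : ℕ} (hk : 1 ≤ k) (n : ℕ) (x : R) :
    ∑ u : Fin n → Fin k, x ^ countLast u = (x + (k - 1)) ^ n := by
  obtain ⟨j, rfl⟩ := Nat.exists_eq_add_of_le' hk
  have hsum : ∑ a : Fin (j + 1), (if (a : ℕ) = j then x else 1) = x + ((j + 1 : ℕ) - 1) := by
    rw [Fin.sum_univ_castSucc]
    simp [Fin.val_castSucc, (Fin.is_lt _).ne, add_comm]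
  rw [← hsum, Fintype.sum_pow]
  refine Finset.sum_congr rfl fun u _ => ?_
  simp [countLast, Finset.prod_ite]

theorem exists_orderOf_eq_and_add_ne_zero {k : ℕ} (hk : 3 ≤ k) (d : ℕ) :
    ∃ x : ℂ, orderOf x = d ∧ x ≠ 0 ∧ x + (k - 1) ≠ 0 := by
  have hk' : (3 : ℝ) ≤ k := by exact_mod_cast hk
  rcases Nat.eq_zero_or_pos d with rfl | hd
  · refine ⟨2, ?_, two_ne_zero, fun h => ?_⟩
    · rw [orderOf_eq_zero_iff']
      intro n hn h
      have : (2 : ℕ) ^ n = 1 := by exact_mod_cast h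
      exact (Nat.one_lt_two_pow hn.ne').ne' this
    · have := congrArg Complex.re h
      simp at this
      linarith
  · have hx := Complex.isPrimitiveRoot_exp d hd.ne'
    refine ⟨_, hx.eq_orderOf.symm, hx.ne_zero hd.ne', fun h => ?_⟩
    have hnorm := hx.norm'_eq_one hd.ne'
    rw [eq_neg_of_add_eq_zero_left h, norm_neg] at hnorm
    have hle := Complex.re_le_norm ((k : ℂ) - 1)
    simp only [Complex.sub_re, Complex.natCast_re, Complex.one_re] at hle
    linarith

/-- If two bijections change `countLast` modulo `d` by amounts that always cancel, then
each of them preserves `countLast` modulo `d`. -/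
theorem modPreserving_of_add_modEq {k n m d : ℕ} (hk : 3 ≤ k) (F : GateFun (Fin k) n)
    (G : GateFun (Fin k) m)
    (h : ∀ u v, countLast (F u) + countLast (G v) ≡ countLast u + countLast v [MOD d]) :
    ModPreserving d (⟨m, G⟩ : Gate (Fin k)) := by
  obtain ⟨x, hxd, hx, hxk⟩ := exists_orderOf_eq_and_add_ne_zero hk d
  subst hxd
  intro v
  have hS : ∑ u : Fin n → Fin k, x ^ countLast u ≠ 0 := by
    rw [sum_pow_countLast (by omega)]
    exact pow_ne_zero n hxk
  have key : (∑ u : Fin n → Fin k, x ^ countLast u) * x ^ countLast (G v) =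
      (∑ u : Fin n → Fin k, x ^ countLast u) * x ^ countLast v := by
    conv_lhs => rw [← Equiv.sum_comp F fun u => x ^ countLast u]
    simp only [Finset.sum_mul, ← pow_add]
    refine Finset.sum_congr rfl fun u _ => ?_
    rw [← pow_mod_orderOf, h u v, pow_mod_orderOf]
  have hpow : Units.mk0 x hx ^ countLast (G v) = Units.mk0 x hx ^ countLast v :=
    Units.ext (by simpa using mul_left_cancel₀ hS key)
  rw [pow_eq_pow_iff_modEq, ← orderOf_units, Units.val_mk0] at hpow
  exact hpow

/-- Over `A = {1,…,k}` with `k ≥ 3`: for any two reversible gates `F`, `G`,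
`m(F ⊗ G) = gcd(m(F), m(G))`. -/
theorem modIndex_tensor (k : ℕ) (hk : 3 ≤ k) {n m : ℕ}
    (F : GateFun (Fin k) n) (G : GateFun (Fin k) m) (mF mG : ℕ)
    (hF : IsModIndex ⟨n, F⟩ mF) (hG : IsModIndex ⟨m, G⟩ mG) :
    IsModIndex (⟨n + m, tensorGate F G⟩ : Gate (Fin k)) (Nat.gcd mF mG) := by
  refine ⟨(modPreserving_tensorGate_iff F G).2 fun u v => ?_, fun d hd => ?_⟩
  · exact ((hF.1 u).of_dvd (Nat.gcd_dvd_left _ _)).add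
      ((hG.1 v).of_dvd (Nat.gcd_dvd_right _ _))
  · rw [modPreserving_tensorGate_iff] at hd
    refine Nat.dvd_gcd (hF.2 d ?_) (hG.2 d (modPreserving_of_add_modEq hk F G hd))
    exact modPreserving_of_add_modEq hk G F fun v u => by
      simpa only [add_comm] using hd u v
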